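/- CESK* correctness: for every program e, eval_CESK*(e) = eval(e), where eval_CESK*(e) = real(v,ρ,σ) whenever the CESK* machine started at ⟨e,∅,[a₀↦mt],a₀⟩ reaches ⟨v,ρ,σ,a₀⟩, and eval is the call-by-value standard-reduction evaluation function. -/

import Mathlib

/-! # Core definitions: call-by-value λ-calculus, CEK, CESK*, timed and
abstract machines, and garbage collection machinery. -/

/-! ## Syntax -/

inductive Exp : Type where
  | var : ℕ → Exp
  | app : Exp → Exp → Exp
  | lam : ℕ → Exp → Exp
deriving DecidableEq

/-- Values are λ-abstractions. -/
def IsValue (e : Exp) : Prop := ∃ x b, e = Exp.lam x b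

/-- Free variables. -/
def fv : Exp → Finset ℕ
  | Exp.var x => {x}
  | Exp.app e₁ e₂ => fv e₁ ∪ fv e₂
  | Exp.lam x b => fv b \ {x}

/-- A program is a closed expression. -/
def Closed (e : Exp) : Prop := fv e = ∅

/-- Substitution `[v/x]e` (capture-avoiding when `v` is closed, as it is
in call-by-value evaluation of programs). -/
def subst (v : Exp) (x : ℕ) : Exp → Exp
  | Exp.var y => if y = x then v else Exp.var y
  | Exp.app e₁ e₂ => Exp.app (subst v x e₁) (subst v x e₂)
  | Exp.lam y b => if y = x then Exp.lam y b else Exp.lam y (subst v x b)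

/-- All variables occurring in an expression (free or bound). -/
def vars : Exp → Finset ℕ
  | Exp.var x => {x}
  | Exp.app e₁ e₂ => vars e₁ ∪ vars e₂
  | Exp.lam x b => insert x (vars b)

/-- All subexpressions of an expression. -/
def subExps : Exp → Finset Exp
  | Exp.var x => {Exp.var x}
  | Exp.app e₁ e₂ => insert (Exp.app e₁ e₂) (subExps e₁ ∪ subExps e₂)
  | Exp.lam x b => insert (Exp.lam x b) (subExps b)

/-! ## Reduction semantics -/

/-- Evaluation contexts `E ::= [] | (E e) | (v E)`. -/
inductive Ctx : Type where
  | hole : Ctx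
  | appL : Ctx → Exp → Ctx
  | appR : Exp → Ctx → Ctx

/-- Well-formed evaluation contexts: in `(v E)` the left part is a value. -/
inductive ECtx : Ctx → Prop where
  | hole : ECtx Ctx.hole
  | appL : ∀ (E : Ctx) (e : Exp), ECtx E → ECtx (Ctx.appL E e)
  | appR : ∀ (v : Exp) (E : Ctx), IsValue v → ECtx E → ECtx (Ctx.appR v E)

/-- Plugging an expression into the hole of a context. -/
def plug : Ctx → Exp → Exp
  | Ctx.hole, e => e
  | Ctx.appL E e', e => Exp.app (plug E e) e'
  | Ctx.appR v E, e => Exp.app v (plug E e)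

/-- The standard call-by-value reduction relation `E[(λx.b) v] ↦ E[[v/x]b]`. -/
inductive StdStep : Exp → Exp → Prop where
  | mk : ∀ (E : Ctx) (x : ℕ) (b v : Exp), ECtx E → IsValue v →
      StdStep (plug E (Exp.app (Exp.lam x b) v)) (plug E (subst v x b))

/-! ## Association-list finite maps -/

/-- Lookup in an association list. -/
def lookupA {β : Type} (ρ : List (ℕ × β)) (x : ℕ) : Option β :=
  (ρ.find? (fun p => p.1 == x)).map Prod.snd

/-- Finite-map update `ρ[x ↦ b]`. -/
def updA {β : Type} (ρ : List (ℕ × β)) (x : ℕ) (b : β) : List (ℕ × β) :=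
  (x, b) :: ρ.filter (fun p => p.1 != x)

/-- Removing a binding (used for shadowing under a binder). -/
def eraseA {β : Type} (ρ : List (ℕ × β)) (x : ℕ) : List (ℕ × β) :=
  ρ.filter (fun p => p.1 != x)

/-! ## The CEK machine -/

/-- Closures: a value paired with an environment. -/
inductive Clo : Type where
  | mk : Exp → List (ℕ × Clo) → Clo

/-- CEK environments map variables to closures. -/
abbrev CEnv : Type := List (ℕ × Clo)

/-- CEK continuations `κ ::= mt | ar(e,ρ,κ) | fn(v,ρ,κ)`. -/
inductive CKont : Type where
  | mt : CKont
  | ar : Exp → CEnv → CKont → CKont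
  | fn : Exp → CEnv → CKont → CKont

structure CEKState : Type where
  exp : Exp
  env : CEnv
  kont : CKont

/-- The CEK transition relation. -/
inductive CEKStep : CEKState → CEKState → Prop where
  | var : ∀ (x : ℕ) (ρ : CEnv) (κ : CKont) (v : Exp) (ρ' : CEnv),
      lookupA ρ x = some (Clo.mk v ρ') →
      CEKStep ⟨Exp.var x, ρ, κ⟩ ⟨v, ρ', κ⟩
  | app : ∀ (e₀ e₁ : Exp) (ρ : CEnv) (κ : CKont),
      CEKStep ⟨Exp.app e₀ e₁, ρ, κ⟩ ⟨e₀, ρ, CKont.ar e₁ ρ κ⟩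
  | ar : ∀ (v : Exp) (ρ : CEnv) (e : Exp) (ρ' : CEnv) (κ : CKont),
      IsValue v →
      CEKStep ⟨v, ρ, CKont.ar e ρ' κ⟩ ⟨e, ρ', CKont.fn v ρ κ⟩
  | fn : ∀ (v : Exp) (ρ : CEnv) (x : ℕ) (e : Exp) (ρ' : CEnv) (κ : CKont),
      IsValue v →
      CEKStep ⟨v, ρ, CKont.fn (Exp.lam x e) ρ' κ⟩ ⟨e, updA ρ' x (Clo.mk v ρ), κ⟩

/-- Initial CEK state. -/
def injCEK (e : Exp) : CEKState := ⟨e, [], CKont.mt⟩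

/-- `RealR v ρ e'` : performing the delayed substitutions recorded in `ρ`
on `v` yields `e'` (the `real` function, as a relation). -/
inductive RealR : Exp → CEnv → Exp → Prop where
  | varHit : ∀ (x : ℕ) (ρ : CEnv) (v : Exp) (ρ' : CEnv) (e' : Exp),
      lookupA ρ x = some (Clo.mk v ρ') → RealR v ρ' e' → RealR (Exp.var x) ρ e'
  | varMiss : ∀ (x : ℕ) (ρ : CEnv),
      lookupA ρ x = none → RealR (Exp.var x) ρ (Exp.var x)
  | app : ∀ (e₀ e₁ : Exp) (ρ : CEnv) (e₀' e₁' : Exp),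
      RealR e₀ ρ e₀' → RealR e₁ ρ e₁' →
      RealR (Exp.app e₀ e₁) ρ (Exp.app e₀' e₁')
  | lam : ∀ (x : ℕ) (b : Exp) (ρ : CEnv) (b' : Exp),
      RealR b (eraseA ρ x) b' → RealR (Exp.lam x b) ρ (Exp.lam x b')

/-! ## The CESK* machine (generic in the type of addresses) -/

/-- Environments mapping variables to addresses. -/
abbrev PEnv (A : Type) : Type := List (ℕ × A)

/-- Continuations with store pointers `κ ::= mt | ar(e,ρ,a) | fn(v,ρ,a)`. -/
inductive Kont (A : Type) : Type where
  | mt : Kont A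
  | ar : Exp → PEnv A → A → Kont A
  | fn : Exp → PEnv A → A → Kont A

/-- Storable values: closures and continuations. -/
inductive Storable (A : Type) : Type where
  | clo : Exp → PEnv A → Storable A
  | kont : Kont A → Storable A

/-- Stores: partial maps from addresses to storables. -/
abbrev Store (A : Type) : Type := A → Option (Storable A)

/-- Store update `σ[b ↦ s]`. -/
def Store.upd {A : Type} [DecidableEq A] (σ : Store A) (b : A) (s : Storable A) : Store A :=
  fun a => if a = b then some s else σ a

structure CeskState (A : Type) : Type where
  exp : Exp
  env : PEnv A
  sto : Store A
  kptr : A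

/-- The CESK* transition relation (the fresh address `b` with `σ b = none`
is chosen nondeterministically; `κ = σ(a)` is the current continuation). -/
inductive CeskStep {A : Type} [DecidableEq A] : CeskState A → CeskState A → Prop where
  | var : ∀ (x : ℕ) (ρ : PEnv A) (σ : Store A) (a : A) (κ : Kont A) (l : A)
      (v : Exp) (ρ' : PEnv A),
      σ a = some (Storable.kont κ) →
      lookupA ρ x = some l → σ l = some (Storable.clo v ρ') →
      CeskStep ⟨Exp.var x, ρ, σ, a⟩ ⟨v, ρ', σ, a⟩
  | app : ∀ (e₀ e₁ : Exp) (ρ : PEnv A) (σ : Store A) (a : A) (κ : Kont A) (b : A),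
      σ a = some (Storable.kont κ) → σ b = none →
      CeskStep ⟨Exp.app e₀ e₁, ρ, σ, a⟩
        ⟨e₀, ρ, Store.upd σ b (Storable.kont (Kont.ar e₁ ρ a)), b⟩
  | ar : ∀ (v : Exp) (ρ : PEnv A) (σ : Store A) (a : A) (e : Exp) (ρ' : PEnv A)
      (c : A) (b : A),
      IsValue v → σ a = some (Storable.kont (Kont.ar e ρ' c)) → σ b = none →
      CeskStep ⟨v, ρ, σ, a⟩
        ⟨e, ρ', Store.upd σ b (Storable.kont (Kont.fn v ρ c)), b⟩
  | fn : ∀ (v : Exp) (ρ : PEnv A) (σ : Store A) (a : A) (x : ℕ) (e : Exp)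
      (ρ' : PEnv A) (c : A) (b : A),
      IsValue v → σ a = some (Storable.kont (Kont.fn (Exp.lam x e) ρ' c)) → σ b = none →
      CeskStep ⟨v, ρ, σ, a⟩
        ⟨e, updA ρ' x b, Store.upd σ b (Storable.clo v ρ), c⟩

/-- The initial store `[a₀ ↦ mt]`. -/
def initStore {A : Type} [DecidableEq A] (a₀ : A) : Store A :=
  fun a => if a = a₀ then some (Storable.kont Kont.mt) else none

/-- Initial CESK* state. -/
def injCesk {A : Type} [DecidableEq A] (a₀ : A) (e : Exp) : CeskState A :=
  ⟨e, [], initStore a₀, a₀⟩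

/-- The `real` function of the CESK* machine: `RealP σ v ρ e'` means that
unfolding the delayed substitutions of `ρ` on `v`, following the
indirection through the store `σ`, yields `e'`. -/
inductive RealP {A : Type} (σ : Store A) : Exp → PEnv A → Exp → Prop where
  | varHit : ∀ (x : ℕ) (ρ : PEnv A) (l : A) (v : Exp) (ρ' : PEnv A) (e' : Exp),
      lookupA ρ x = some l → σ l = some (Storable.clo v ρ') →
      RealP σ v ρ' e' → RealP σ (Exp.var x) ρ e'
  | varMiss : ∀ (x : ℕ) (ρ : PEnv A),
      lookupA ρ x = none → RealP σ (Exp.var x) ρ (Exp.var x)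
  | app : ∀ (e₀ e₁ : Exp) (ρ : PEnv A) (e₀' e₁' : Exp),
      RealP σ e₀ ρ e₀' → RealP σ e₁ ρ e₁' →
      RealP σ (Exp.app e₀ e₁) ρ (Exp.app e₀' e₁')
  | lam : ∀ (x : ℕ) (b : Exp) (ρ : PEnv A) (b' : Exp),
      RealP σ b (eraseA ρ x) b' → RealP σ (Exp.lam x b) ρ (Exp.lam x b')

/-! ## Renaming of addresses -/

def renEnv {A B : Type} (f : A → B) (ρ : PEnv A) : PEnv B :=
  ρ.map (fun p => (p.1, f p.2))

def Kont.ren {A B : Type} (f : A → B) : Kont A → Kont B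
  | Kont.mt => Kont.mt
  | Kont.ar e ρ a => Kont.ar e (renEnv f ρ) (f a)
  | Kont.fn v ρ a => Kont.fn v (renEnv f ρ) (f a)

def Storable.ren {A B : Type} (f : A → B) : Storable A → Storable B
  | Storable.clo v ρ => Storable.clo v (renEnv f ρ)
  | Storable.kont κ => Storable.kont (Kont.ren f κ)

/-- Renaming a store along a bijection of addresses. -/
def Store.ren {A : Type} (π : A ≃ A) (σ : Store A) : Store A :=
  fun a => (σ (π.symm a)).map (Storable.ren π)

/-- A consistent renaming of addresses, applied uniformly throughout a state. -/
def CeskState.ren {A : Type} (π : A ≃ A) (ς : CeskState A) : CeskState A :=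
  ⟨ς.exp, renEnv π ς.env, Store.ren π ς.sto, π ς.kptr⟩

/-! ## The time-stamped CESK* machine -/

structure TState (A T : Type) : Type where
  exp : Exp
  env : PEnv A
  sto : Store A
  kptr : A
  time : T

/-- The time-stamped CESK* transition relation, parameterized by `alloc`
and `tick`. -/
inductive TStep {A T : Type} [DecidableEq A]
    (alloc : TState A T → A) (tick : TState A T → T) :
    TState A T → TState A T → Prop where
  | var : ∀ (x : ℕ) (ρ : PEnv A) (σ : Store A) (a : A) (t : T) (κ : Kont A)
      (l : A) (v : Exp) (ρ' : PEnv A),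
      σ a = some (Storable.kont κ) →
      lookupA ρ x = some l → σ l = some (Storable.clo v ρ') →
      TStep alloc tick ⟨Exp.var x, ρ, σ, a, t⟩
        ⟨v, ρ', σ, a, tick ⟨Exp.var x, ρ, σ, a, t⟩⟩
  | app : ∀ (e₀ e₁ : Exp) (ρ : PEnv A) (σ : Store A) (a : A) (t : T) (κ : Kont A),
      σ a = some (Storable.kont κ) →
      TStep alloc tick ⟨Exp.app e₀ e₁, ρ, σ, a, t⟩
        ⟨e₀, ρ,
         Store.upd σ (alloc ⟨Exp.app e₀ e₁, ρ, σ, a, t⟩)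
           (Storable.kont (Kont.ar e₁ ρ a)),
         alloc ⟨Exp.app e₀ e₁, ρ, σ, a, t⟩, tick ⟨Exp.app e₀ e₁, ρ, σ, a, t⟩⟩
  | ar : ∀ (v : Exp) (ρ : PEnv A) (σ : Store A) (a : A) (t : T) (e : Exp)
      (ρ' : PEnv A) (c : A),
      IsValue v → σ a = some (Storable.kont (Kont.ar e ρ' c)) →
      TStep alloc tick ⟨v, ρ, σ, a, t⟩
        ⟨e, ρ',
         Store.upd σ (alloc ⟨v, ρ, σ, a, t⟩) (Storable.kont (Kont.fn v ρ c)),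
         alloc ⟨v, ρ, σ, a, t⟩, tick ⟨v, ρ, σ, a, t⟩⟩
  | fn : ∀ (v : Exp) (ρ : PEnv A) (σ : Store A) (a : A) (t : T) (x : ℕ)
      (e : Exp) (ρ' : PEnv A) (c : A),
      IsValue v → σ a = some (Storable.kont (Kont.fn (Exp.lam x e) ρ' c)) →
      TStep alloc tick ⟨v, ρ, σ, a, t⟩
        ⟨e, updA ρ' x (alloc ⟨v, ρ, σ, a, t⟩),
         Store.upd σ (alloc ⟨v, ρ, σ, a, t⟩) (Storable.clo v ρ), c,
         tick ⟨v, ρ, σ, a, t⟩⟩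

/-- Initial time-stamped CESK* state. -/
def injT {A T : Type} [DecidableEq A] (a₀ : A) (t₀ : T) (e : Exp) : TState A T :=
  ⟨e, [], initStore a₀, a₀, t₀⟩

/-- Erasing the time stamp. -/
def eraseT {A T : Type} (ς : TState A T) : CeskState A :=
  ⟨ς.exp, ς.env, ς.sto, ς.kptr⟩

/-- Correspondence between time-stamped and plain CESK* states: equality
after erasing the time stamp, up to a consistent renaming of addresses. -/
def TCorr {A T : Type} (ς : TState A T) (ς' : CeskState A) : Prop :=
  ∃ π : A ≃ A, CeskState.ren π (eraseT ς) = ς'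

/-! ## The abstract time-stamped CESK* machine -/

/-- Abstract stores map addresses to *sets* of storables. -/
abbrev AStore (A : Type) : Type := A → Set (Storable A)

/-- Pointwise order on abstract stores. -/
def AStore.le {A : Type} (σ₁ σ₂ : AStore A) : Prop := ∀ a, σ₁ a ⊆ σ₂ a

/-- Store join `σ ⊔ [b ↦ s]`. -/
def AStore.join {A : Type} [DecidableEq A] (σ : AStore A) (b : A) (s : Storable A) :
    AStore A :=
  fun a => if a = b then insert s (σ a) else σ a

/-- Abstraction of a concrete store along an abstraction of addresses:
`α(σ) = λâ.⊔_{α(a)=â} {α(σ(a))}`. -/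
def absStore {A B : Type} (αA : A → B) (σ : Store A) : AStore B :=
  fun b => { s' | ∃ (a : A) (s : Storable A), αA a = b ∧ σ a = some s ∧ s' = Storable.ren αA s }

structure AState (A T : Type) : Type where
  exp : Exp
  env : PEnv A
  sto : AStore A
  kptr : A
  time : T

/-- Abstraction map on time-stamped states, acting componentwise. -/
def αTS {A T B S : Type} (αA : A → B) (αT : T → S) (ς : TState A T) : AState B S :=
  ⟨ς.exp, renEnv αA ς.env, absStore αA ς.sto, αA ς.kptr, αT ς.time⟩

/-- The order `⊑` on abstract states: pointwise/memberwise on stores, the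
given order on times, and flat (equality) on the other components. -/
def AState.le {A T : Type} [Preorder T] (ς₁ ς₂ : AState A T) : Prop :=
  ς₁.exp = ς₂.exp ∧ ς₁.env = ς₂.env ∧ AStore.le ς₁.sto ς₂.sto ∧
    ς₁.kptr = ς₂.kptr ∧ ς₁.time ≤ ς₂.time

/-- The abstract time-stamped CESK* transition relation, parameterized by
`alloĉ` and `tick̂` (which take the state together with the chosen
continuation `κ ∈ σ̂(a)`). -/
inductive AStep {A T : Type} [DecidableEq A]
    (allocA : AState A T → Kont A → A) (tickA : AState A T → Kont A → T) :
    AState A T → AState A T → Prop where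
  | var : ∀ (x : ℕ) (ρ : PEnv A) (σ : AStore A) (a : A) (t : T) (κ : Kont A)
      (l : A) (v : Exp) (ρ' : PEnv A),
      Storable.kont κ ∈ σ a → lookupA ρ x = some l →
      Storable.clo v ρ' ∈ σ l →
      AStep allocA tickA ⟨Exp.var x, ρ, σ, a, t⟩
        ⟨v, ρ', σ, a, tickA ⟨Exp.var x, ρ, σ, a, t⟩ κ⟩
  | app : ∀ (e₀ e₁ : Exp) (ρ : PEnv A) (σ : AStore A) (a : A) (t : T) (κ : Kont A),
      Storable.kont κ ∈ σ a →
      AStep allocA tickA ⟨Exp.app e₀ e₁, ρ, σ, a, t⟩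
        ⟨e₀, ρ,
         AStore.join σ (allocA ⟨Exp.app e₀ e₁, ρ, σ, a, t⟩ κ)
           (Storable.kont (Kont.ar e₁ ρ a)),
         allocA ⟨Exp.app e₀ e₁, ρ, σ, a, t⟩ κ,
         tickA ⟨Exp.app e₀ e₁, ρ, σ, a, t⟩ κ⟩
  | ar : ∀ (v : Exp) (ρ : PEnv A) (σ : AStore A) (a : A) (t : T) (e : Exp)
      (ρ' : PEnv A) (c : A),
      IsValue v → Storable.kont (Kont.ar e ρ' c) ∈ σ a →
      AStep allocA tickA ⟨v, ρ, σ, a, t⟩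
        ⟨e, ρ',
         AStore.join σ (allocA ⟨v, ρ, σ, a, t⟩ (Kont.ar e ρ' c))
           (Storable.kont (Kont.fn v ρ c)),
         allocA ⟨v, ρ, σ, a, t⟩ (Kont.ar e ρ' c),
         tickA ⟨v, ρ, σ, a, t⟩ (Kont.ar e ρ' c)⟩
  | fn : ∀ (v : Exp) (ρ : PEnv A) (σ : AStore A) (a : A) (t : T) (x : ℕ)
      (e : Exp) (ρ' : PEnv A) (c : A),
      IsValue v → Storable.kont (Kont.fn (Exp.lam x e) ρ' c) ∈ σ a →
      AStep allocA tickA ⟨v, ρ, σ, a, t⟩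
        ⟨e, updA ρ' x (allocA ⟨v, ρ, σ, a, t⟩ (Kont.fn (Exp.lam x e) ρ' c)),
         AStore.join σ (allocA ⟨v, ρ, σ, a, t⟩ (Kont.fn (Exp.lam x e) ρ' c))
           (Storable.clo v ρ),
         c, tickA ⟨v, ρ, σ, a, t⟩ (Kont.fn (Exp.lam x e) ρ' c)⟩

/-! ## Correspondence between CEK states and (time-stamped) CESK* states -/

/-- `EnvC σ ρp ρ`: the pointer environment `ρp` corresponds, through the
store `σ`, to the CEK environment `ρ`. -/
inductive EnvC {A : Type} (σ : Store A) : PEnv A → CEnv → Prop where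
  | nil : EnvC σ [] []
  | cons : ∀ (x : ℕ) (l : A) (v : Exp) (ρp' : PEnv A) (ρ' : CEnv)
      (ρp : PEnv A) (ρ : CEnv),
      σ l = some (Storable.clo v ρp') → EnvC σ ρp' ρ' → EnvC σ ρp ρ →
      EnvC σ ((x, l) :: ρp) ((x, Clo.mk v ρ') :: ρ)

/-- `KontC σ a κ`: the continuation pointer `a` corresponds, through the
store `σ`, to the CEK continuation `κ`. -/
inductive KontC {A : Type} (σ : Store A) : A → CKont → Prop where
  | mt : ∀ (a : A), σ a = some (Storable.kont Kont.mt) → KontC σ a CKont.mt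
  | ar : ∀ (a : A) (e : Exp) (ρp : PEnv A) (c : A) (ρ : CEnv) (κ : CKont),
      σ a = some (Storable.kont (Kont.ar e ρp c)) →
      EnvC σ ρp ρ → KontC σ c κ → KontC σ a (CKont.ar e ρ κ)
  | fn : ∀ (a : A) (v : Exp) (ρp : PEnv A) (c : A) (ρ : CEnv) (κ : CKont),
      σ a = some (Storable.kont (Kont.fn v ρp c)) →
      EnvC σ ρp ρ → KontC σ c κ → KontC σ a (CKont.fn v ρ κ)

/-- The lock-step correspondence between a CEK state and a time-stamped
CESK* state. -/
def StateC {A T : Type} (ς : CEKState) (ςt : TState A T) : Prop :=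
  ς.exp = ςt.exp ∧ EnvC ςt.sto ςt.env ς.env ∧ KontC ςt.sto ςt.kptr ς.kont

/-! ## Well-formed abstract states over a program (for finiteness) -/

def WFEnv {A : Type} (e : Exp) (ρ : PEnv A) : Prop :=
  (ρ.map Prod.fst).Nodup ∧ ∀ p ∈ ρ, p.1 ∈ vars e

def WFKont {A : Type} (e : Exp) : Kont A → Prop
  | Kont.mt => True
  | Kont.ar e' ρ _ => e' ∈ subExps e ∧ WFEnv e ρ
  | Kont.fn v ρ _ => v ∈ subExps e ∧ WFEnv e ρ

def WFStorable {A : Type} (e : Exp) : Storable A → Prop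
  | Storable.clo v ρ => v ∈ subExps e ∧ WFEnv e ρ
  | Storable.kont κ => WFKont e κ

/-- Abstract states all of whose components are built from the (finitely
many) subexpressions and variables of the program `e`. -/
def WFState {A T : Type} (e : Exp) (ς : AState A T) : Prop :=
  ς.exp ∈ subExps e ∧ WFEnv e ς.env ∧
    ∀ (a : A) (s : Storable A), s ∈ ς.sto a → WFStorable e s

/-- The abstraction of the initial time-stamped CESK* state, as an
abstract state. -/
def injA {A T : Type} [DecidableEq A] (a₀ : A) (t₀ : T) (e : Exp) : AState A T :=
  ⟨e, [], fun a => if a = a₀ then {Storable.kont Kont.mt} else ∅, a₀, t₀⟩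

/-! ## Garbage collection -/

/-- `envLive ρ e` : the range of `ρ` restricted to the free variables of
`e` — the live locations `L_σ(e,ρ)` contributed by a closure. -/
def envLive {A : Type} (ρ : PEnv A) (e : Exp) : Set A :=
  { l | ∃ x ∈ fv e, lookupA ρ x = some l }

/-- `LiveIn σ s l` : the address `l` is among the live locations
`L_σ(s)` of the storable `s` (least fixed point). -/
inductive LiveIn {A : Type} (σ : Store A) : Storable A → A → Prop where
  | clo : ∀ (v : Exp) (ρ : PEnv A) (l : A),
      l ∈ envLive ρ v → LiveIn σ (Storable.clo v ρ) l
  | arSelf : ∀ (e : Exp) (ρ : PEnv A) (a : A),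
      LiveIn σ (Storable.kont (Kont.ar e ρ a)) a
  | arEnv : ∀ (e : Exp) (ρ : PEnv A) (a : A) (l : A),
      l ∈ envLive ρ e → LiveIn σ (Storable.kont (Kont.ar e ρ a)) l
  | arRec : ∀ (e : Exp) (ρ : PEnv A) (a : A) (s : Storable A) (l : A),
      σ a = some s → LiveIn σ s l → LiveIn σ (Storable.kont (Kont.ar e ρ a)) l
  | fnSelf : ∀ (v : Exp) (ρ : PEnv A) (a : A),
      LiveIn σ (Storable.kont (Kont.fn v ρ a)) a
  | fnEnv : ∀ (v : Exp) (ρ : PEnv A) (a : A) (l : A),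
      l ∈ envLive ρ v → LiveIn σ (Storable.kont (Kont.fn v ρ a)) l
  | fnRec : ∀ (v : Exp) (ρ : PEnv A) (a : A) (s : Storable A) (l : A),
      σ a = some s → LiveIn σ s l → LiveIn σ (Storable.kont (Kont.fn v ρ a)) l

/-- `L_σ(σ(a))`, the live locations of the storable at address `a`. -/
def liveOfAddr {A : Type} (σ : Store A) (a : A) : Set A :=
  { l | ∃ s : Storable A, σ a = some s ∧ LiveIn σ s l }

/-- States of the GC machine: grey locations, black locations, store. -/
structure GCState (A : Type) : Type where
  grey : Set A
  black : Set A
  sto : Store A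

/-- The GC machine transition. -/
inductive GCStep {A : Type} : GCState A → GCState A → Prop where
  | mk : ∀ (G B : Set A) (σ : Store A) (a : A),
      a ∈ G →
      GCStep ⟨G, B, σ⟩ ⟨(G ∪ liveOfAddr σ a) \ (insert a B), insert a B, σ⟩

/-- The set of store locations reachable from the initial grey set `G₀`:
the least set containing `G₀` and closed under `a ↦ L_σ(σ(a))`. -/
inductive ReachAddr {A : Type} (σ : Store A) (G₀ : Set A) : A → Prop where
  | base : ∀ (a : A), a ∈ G₀ → ReachAddr σ G₀ a
  | step : ∀ (a l : A), ReachAddr σ G₀ a → l ∈ liveOfAddr σ a → ReachAddr σ G₀ l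

-- Restriction of a store to a set of live locations.
open Classical in
noncomputable def Store.restrict {A : Type} (σ : Store A) (L : Set A) : Store A :=
  fun l => if l ∈ L then σ l else none

/-- The GC transition of the CESK* machine. -/
inductive CGCTrans {A : Type} : CeskState A → CeskState A → Prop where
  | mk : ∀ (e : Exp) (ρ : PEnv A) (σ : Store A) (a : A) (L : Set A),
      Relation.ReflTransGen GCStep
        ⟨envLive ρ e ∪ liveOfAddr σ a, {a}, σ⟩ ⟨∅, L, σ⟩ →
      CGCTrans ⟨e, ρ, σ, a⟩ ⟨e, ρ, Store.restrict σ L, a⟩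

/-! ### Abstract garbage collection -/

/-- Live locations of an abstract storable in an abstract store (with the
live-location function extended to the sets of storables stored at an
address by taking unions). -/
inductive ALiveIn {A : Type} (σ : AStore A) : Storable A → A → Prop where
  | clo : ∀ (v : Exp) (ρ : PEnv A) (l : A),
      l ∈ envLive ρ v → ALiveIn σ (Storable.clo v ρ) l
  | arSelf : ∀ (e : Exp) (ρ : PEnv A) (a : A),
      ALiveIn σ (Storable.kont (Kont.ar e ρ a)) a
  | arEnv : ∀ (e : Exp) (ρ : PEnv A) (a : A) (l : A),
      l ∈ envLive ρ e → ALiveIn σ (Storable.kont (Kont.ar e ρ a)) l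
  | arRec : ∀ (e : Exp) (ρ : PEnv A) (a : A) (s : Storable A) (l : A),
      s ∈ σ a → ALiveIn σ s l → ALiveIn σ (Storable.kont (Kont.ar e ρ a)) l
  | fnSelf : ∀ (v : Exp) (ρ : PEnv A) (a : A),
      ALiveIn σ (Storable.kont (Kont.fn v ρ a)) a
  | fnEnv : ∀ (v : Exp) (ρ : PEnv A) (a : A) (l : A),
      l ∈ envLive ρ v → ALiveIn σ (Storable.kont (Kont.fn v ρ a)) l
  | fnRec : ∀ (v : Exp) (ρ : PEnv A) (a : A) (s : Storable A) (l : A),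
      s ∈ σ a → ALiveIn σ s l → ALiveIn σ (Storable.kont (Kont.fn v ρ a)) l

/-- `L_σ̂(σ̂(â))`, the live locations of the set of storables at `â`. -/
def aliveOfAddr {A : Type} (σ : AStore A) (a : A) : Set A :=
  { l | ∃ s ∈ σ a, ALiveIn σ s l }

structure AGCState (A : Type) : Type where
  grey : Set A
  black : Set A
  sto : AStore A

inductive AGCStep {A : Type} : AGCState A → AGCState A → Prop where
  | mk : ∀ (G B : Set A) (σ : AStore A) (a : A),
      a ∈ G →
      AGCStep ⟨G, B, σ⟩ ⟨(G ∪ aliveOfAddr σ a) \ (insert a B), insert a B, σ⟩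

-- Restriction of an abstract store to a set of live locations.
open Classical in
noncomputable def AStore.restrict {A : Type} (σ : AStore A) (L : Set A) : AStore A :=
  fun l => if l ∈ L then σ l else ∅

/-- Abstract CESK* states (no time stamps), for abstract GC. -/
structure ACeskState (A : Type) : Type where
  exp : Exp
  env : PEnv A
  sto : AStore A
  kptr : A

/-- Abstraction map on CESK* states. -/
def αCS {A B : Type} (αA : A → B) (ς : CeskState A) : ACeskState B :=
  ⟨ς.exp, renEnv αA ς.env, absStore αA ς.sto, αA ς.kptr⟩

def ACeskState.le {A : Type} (ς₁ ς₂ : ACeskState A) : Prop :=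
  ς₁.exp = ς₂.exp ∧ ς₁.env = ς₂.env ∧ AStore.le ς₁.sto ς₂.sto ∧ ς₁.kptr = ς₂.kptr

/-- The abstract GC transition. -/
inductive AGCTrans {A : Type} : ACeskState A → ACeskState A → Prop where
  | mk : ∀ (e : Exp) (ρ : PEnv A) (σ : AStore A) (a : A) (L : Set A),
      Relation.ReflTransGen AGCStep
        ⟨envLive ρ e ∪ aliveOfAddr σ a, {a}, σ⟩ ⟨∅, L, σ⟩ →
      AGCTrans ⟨e, ρ, σ, a⟩ ⟨e, ρ, AStore.restrict σ L, a⟩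

/-! ## Finite maps -/

theorem lookupA_cons {β : Type} (y x : ℕ) (b : β) (ρ : List (ℕ × β)) :
    lookupA ((y, b) :: ρ) x = if y = x then some b else lookupA ρ x := by
  by_cases h : y = x <;> simp [lookupA, h]

theorem lookupA_eraseA {β : Type} (ρ : List (ℕ × β)) (x y : ℕ) :
    lookupA (eraseA ρ x) y = if y = x then none else lookupA ρ y := by
  induction ρ with
  | nil => simp [lookupA, eraseA]
  | cons p ρ ih =>
    obtain ⟨z, b⟩ := p
    by_cases hz : z = x
    · have h : eraseA ((z, b) :: ρ) x = eraseA ρ x := by simp [eraseA, hz]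
      rw [h, ih, lookupA_cons]
      grind
    · have h : eraseA ((z, b) :: ρ) x = (z, b) :: eraseA ρ x := by simp [eraseA, hz]
      rw [h, lookupA_cons, lookupA_cons, ih]
      grind

theorem lookupA_updA {β : Type} (ρ : List (ℕ × β)) (x : ℕ) (b : β) (y : ℕ) :
    lookupA (updA ρ x b) y = if y = x then some b else lookupA ρ y := by
  change lookupA ((x, b) :: eraseA ρ x) y = _
  rw [lookupA_cons, lookupA_eraseA]
  grind

/-! ## Closed expressions and substitution -/

theorem closed_app {e₀ e₁ : Exp} : Closed (Exp.app e₀ e₁) ↔ Closed e₀ ∧ Closed e₁ := by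
  simp [Closed, fv]

theorem not_closed_var (x : ℕ) : ¬ Closed (Exp.var x) := by
  simp [Closed, fv]

theorem subst_eq_self (v : Exp) (x : ℕ) {e : Exp} (h : x ∉ fv e) : subst v x e = e := by
  induction e with
  | var y => simp only [fv, Finset.mem_singleton] at h; simp [subst, Ne.symm h]
  | app e₀ e₁ ih₀ ih₁ =>
    simp only [fv, Finset.mem_union, not_or] at h
    simp [subst, ih₀ h.1, ih₁ h.2]
  | lam y b ih =>
    by_cases hy : y = x
    · simp [subst, hy]
    · simp only [fv, Finset.mem_sdiff, Finset.mem_singleton, not_and, not_not] at h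
      have hx : x ∉ fv b := fun hb => hy (h hb).symm
      simp [subst, ih hx]

theorem Closed.subst_eq_self {e : Exp} (h : Closed e) (v : Exp) (x : ℕ) : subst v x e = e :=
  _root_.subst_eq_self v x (by rw [show fv e = ∅ from h]; simp)

theorem fv_subst_subset {v : Exp} (hv : Closed v) (x : ℕ) (e : Exp) :
    fv (subst v x e) ⊆ fv e \ {x} := by
  have hv' : fv v = ∅ := hv
  induction e with
  | var y =>
    by_cases hy : y = x
    · simp [subst, hy, hv']
    · simp [subst, hy, fv]
  | app e₀ e₁ ih₀ ih₁ =>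
    intro z hz
    simp only [subst, fv, Finset.mem_union] at hz
    have h₀ := @ih₀ z
    have h₁ := @ih₁ z
    simp only [fv, Finset.mem_sdiff, Finset.mem_union] at *
    tauto
  | lam y b ih =>
    intro z hz
    have h := @ih z
    by_cases hy : y = x
    · subst hy
      simp_all [subst, fv]
    · simp only [subst, hy, if_false, fv, Finset.mem_sdiff, Finset.mem_singleton] at *
      tauto

theorem closed_subst {x : ℕ} {b v : Exp} (hb : Closed (Exp.lam x b)) (hv : Closed v) :
    Closed (subst v x b) :=
  Finset.subset_empty.mp ((fv_subst_subset hv x b).trans (Finset.subset_empty.mpr hb))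

/-! ## Standard reduction and its big-step characterization -/

theorem StdStep.appL {e e' : Exp} (h : StdStep e e') (e₁ : Exp) :
    StdStep (Exp.app e e₁) (Exp.app e' e₁) := by
  obtain ⟨E, x, b, v, hE, hv⟩ := h
  exact StdStep.mk (Ctx.appL E e₁) x b v (ECtx.appL E e₁ hE) hv

theorem StdStep.appR {e e' w : Exp} (h : StdStep e e') (hw : IsValue w) :
    StdStep (Exp.app w e) (Exp.app w e') := by
  obtain ⟨E, x, b, v, hE, hv⟩ := h
  exact StdStep.mk (Ctx.appR w E) x b v (ECtx.appR w E hw hE) hv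

/-- Big-step call-by-value evaluation. -/
inductive BigStep : Exp → Exp → Prop where
  | lam (x : ℕ) (b : Exp) : BigStep (Exp.lam x b) (Exp.lam x b)
  | app {e₀ e₁ : Exp} {x : ℕ} {b v w : Exp} :
      BigStep e₀ (Exp.lam x b) → BigStep e₁ v → BigStep (subst v x b) w →
      BigStep (Exp.app e₀ e₁) w

theorem BigStep.of_isValue {v : Exp} (h : IsValue v) : BigStep v v := by
  obtain ⟨x, b, rfl⟩ := h
  exact BigStep.lam x b

theorem BigStep.isValue {e v : Exp} (h : BigStep e v) : IsValue v := by
  induction h with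
  | lam x b => exact ⟨x, b, rfl⟩
  | app _ _ _ _ _ ih => exact ih

theorem StdStep.bigStep {e e' w : Exp} (h : StdStep e e') (h' : BigStep e' w) :
    BigStep e w := by
  obtain ⟨E, x, b, v, hE, hv⟩ := h
  induction hE generalizing w with
  | hole => exact BigStep.app (BigStep.lam x b) (BigStep.of_isValue hv) h'
  | appL E e₁ _ ih =>
    cases h' with
    | app h₀ h₁ h₂ => exact BigStep.app (ih h₀) h₁ h₂
  | appR u E _ _ ih =>
    cases h' with
    | app h₀ h₁ h₂ => exact BigStep.app h₀ (ih h₁) h₂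

theorem bigStep_of_reflTransGen {e v : Exp} (h : Relation.ReflTransGen StdStep e v)
    (hv : IsValue v) : BigStep e v := by
  induction h using Relation.ReflTransGen.head_induction_on with
  | refl => exact BigStep.of_isValue hv
  | head h _ ih => exact h.bigStep ih

/-! ## Store extension and the `real` relation -/

/-- `σ'` extends `σ`. -/
def Store.Ext {A : Type} (σ σ' : Store A) : Prop := ∀ a s, σ a = some s → σ' a = some s

theorem Store.Ext.trans {A : Type} {σ₁ σ₂ σ₃ : Store A} (h : σ₁.Ext σ₂) (h' : σ₂.Ext σ₃) :
    σ₁.Ext σ₃ := fun a s hs => h' a s (h a s hs)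

section

variable {A : Type} {σ : Store A}

theorem Store.upd_self [DecidableEq A] (σ : Store A) (b : A) (s : Storable A) :
    σ.upd b s b = some s := by simp [Store.upd]

theorem Store.upd_of_ne [DecidableEq A] (σ : Store A) {a b : A} (s : Storable A) (h : a ≠ b) :
    σ.upd b s a = σ a := by simp [Store.upd, h]

theorem Store.ext_upd [DecidableEq A] {b : A} (hb : σ b = none) (s : Storable A) :
    σ.Ext (σ.upd b s) := by
  intro a t ha
  rw [Store.upd_of_ne, ha]
  rintro rfl
  simp [hb] at ha

theorem RealP.mono {σ' : Store A} (hσ : σ.Ext σ') {e e' : Exp} {ρ : PEnv A}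
    (h : RealP σ e ρ e') : RealP σ' e ρ e' := by
  induction h with
  | varHit x ρ l v ρ' e' hl hs _ ih => exact .varHit x ρ l v ρ' e' hl (hσ _ _ hs) ih
  | varMiss x ρ hl => exact .varMiss x ρ hl
  | app e₀ e₁ ρ e₀' e₁' _ _ ih₀ ih₁ => exact .app _ _ _ _ _ ih₀ ih₁
  | lam x b ρ b' _ ih => exact .lam _ _ _ _ ih

theorem RealP.deterministic {e e₁ e₂ : Exp} {ρ : PEnv A}
    (h₁ : RealP σ e ρ e₁) (h₂ : RealP σ e ρ e₂) : e₁ = e₂ := by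
  induction h₁ generalizing e₂ with
  | varHit x ρ l v ρ' e' hl hs _ ih =>
    cases h₂ with
    | varHit _ _ l' v' ρ'' _ hl' hs' h =>
      obtain rfl : l = l' := by simpa [hl] using hl'
      obtain ⟨rfl, rfl⟩ : v = v' ∧ ρ' = ρ'' := by simpa [hs] using hs'
      exact ih h
    | varMiss _ _ hl' => simp [hl] at hl'
  | varMiss x ρ hl =>
    cases h₂ with
    | varHit _ _ l' v' ρ'' _ hl' hs' h => simp [hl] at hl'
    | varMiss _ _ hl' => rfl
  | app e₀ e₁ ρ e₀' e₁' _ _ ih₀ ih₁ =>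
    cases h₂ with
    | app _ _ _ _ _ h h' => rw [ih₀ h, ih₁ h']
  | lam x b ρ b' _ ih =>
    cases h₂ with
    | lam _ _ _ _ h => rw [ih h]

theorem RealP.congr_env {e e' : Exp} {ρ ρ₂ : PEnv A} (h : RealP σ e ρ e')
    (hρ : ∀ y, lookupA ρ₂ y = lookupA ρ y) : RealP σ e ρ₂ e' := by
  induction h generalizing ρ₂ with
  | varHit x ρ l v ρ' e' hl hs h _ =>
    exact .varHit x ρ₂ l v ρ' e' ((hρ x).trans hl) hs h
  | varMiss x ρ hl => exact .varMiss x ρ₂ ((hρ x).trans hl)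
  | app e₀ e₁ ρ e₀' e₁' _ _ ih₀ ih₁ => exact .app _ _ _ _ _ (ih₀ hρ) (ih₁ hρ)
  | lam x b ρ b' _ ih =>
    exact .lam _ _ _ _ (ih fun y => by simp [lookupA_eraseA, hρ])

theorem RealP.isValue {e e' : Exp} {ρ : PEnv A} (h : RealP σ e ρ e') (he : IsValue e) :
    IsValue e' := by
  obtain ⟨x, b, rfl⟩ := he
  cases h with
  | lam _ _ _ b' _ => exact ⟨x, b', rfl⟩

theorem RealP.nil (σ : Store A) (e : Exp) : RealP σ e [] e := by
  induction e with
  | var x => exact .varMiss x [] rfl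
  | app e₀ e₁ ih₀ ih₁ => exact .app _ _ _ _ _ ih₀ ih₁
  | lam x b ih => exact .lam _ _ _ _ ih

/-- Every closure in the store is a value whose unfolding is a closed expression. -/
def Store.ClosedClo (σ : Store A) : Prop :=
  ∀ l v ρ, σ l = some (Storable.clo v ρ) → IsValue v ∧ ∃ v', RealP σ v ρ v' ∧ Closed v'

theorem Store.ClosedClo.closed {l : A} {v v' : Exp} {ρ : PEnv A} (hσ : σ.ClosedClo)
    (hl : σ l = some (Storable.clo v ρ)) (h : RealP σ v ρ v') : Closed v' := by
  obtain ⟨_, w, hw, hc⟩ := hσ l v ρ hl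
  exact hw.deterministic h ▸ hc

theorem Store.ClosedClo.upd_kont [DecidableEq A] {b : A} (hσ : σ.ClosedClo) (hb : σ b = none)
    (κ : Kont A) : (σ.upd b (Storable.kont κ)).ClosedClo := by
  intro l v ρ hl
  by_cases h : l = b
  · subst h
    simp [Store.upd_self] at hl
  · rw [Store.upd_of_ne σ _ h] at hl
    obtain ⟨hv, v', hr, hc⟩ := hσ l v ρ hl
    exact ⟨hv, v', hr.mono (Store.ext_upd hb _), hc⟩

theorem Store.ClosedClo.upd_clo [DecidableEq A] {b : A} {w w' : Exp} {ρw : PEnv A}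
    (hσ : σ.ClosedClo) (hb : σ b = none) (hw : IsValue w) (hr : RealP σ w ρw w')
    (hc : Closed w') : (σ.upd b (Storable.clo w ρw)).ClosedClo := by
  intro l v ρ hl
  by_cases h : l = b
  · subst h
    obtain ⟨rfl, rfl⟩ : w = v ∧ ρw = ρ := by simpa [Store.upd_self] using hl
    exact ⟨hw, w', hr.mono (Store.ext_upd hb _), hc⟩
  · rw [Store.upd_of_ne σ _ h] at hl
    obtain ⟨hv, v', hr, hc⟩ := hσ l v ρ hl
    exact ⟨hv, v', hr.mono (Store.ext_upd hb _), hc⟩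

/-- Binding a variable in the environment amounts to substituting in the unfolding. -/
theorem RealP.bind {b b' v v' : Exp} {ρ ρ₂ ρv : PEnv A} {x : ℕ} {l : A}
    (h : RealP σ b ρ b') (hσ : σ.ClosedClo)
    (hl : σ l = some (Storable.clo v ρv)) (hv : RealP σ v ρv v')
    (hx : lookupA ρ x = none) (hx₂ : lookupA ρ₂ x = some l)
    (hne : ∀ y, y ≠ x → lookupA ρ₂ y = lookupA ρ y) :
    RealP σ b ρ₂ (subst v' x b') := by
  induction h generalizing ρ₂ with
  | varHit y ρ k w ρ' e' hk hs h _ =>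
    have hy : y ≠ x := by
      rintro rfl
      simp [hx] at hk
    rw [(hσ.closed hs h).subst_eq_self]
    exact .varHit y ρ₂ k w ρ' e' ((hne y hy).trans hk) hs h
  | varMiss y ρ hk =>
    by_cases hy : y = x
    · subst hy
      simpa [subst] using RealP.varHit y ρ₂ l v ρv v' hx₂ hl hv
    · simpa [subst, hy] using RealP.varMiss (σ := σ) y ρ₂ ((hne y hy).trans hk)
  | app e₀ e₁ ρ e₀' e₁' _ _ ih₀ ih₁ =>
    exact .app _ _ _ _ _ (ih₀ hx hx₂ hne) (ih₁ hx hx₂ hne)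
  | lam y b ρ b' h ih =>
    by_cases hy : y = x
    · subst hy
      rw [show subst v' y (Exp.lam y b') = Exp.lam y b' by simp [subst]]
      refine .lam _ _ _ _ (h.congr_env fun z => ?_)
      by_cases hz : z = y
      · simp [lookupA_eraseA, hz]
      · simp [lookupA_eraseA, hz, hne]
    · rw [show subst v' x (Exp.lam y b') = Exp.lam y (subst v' x b') by simp [subst, hy]]
      refine .lam _ _ _ _ (ih ?_ ?_ ?_)
      · simp [lookupA_eraseA, hx]
      · simp [lookupA_eraseA, hx₂, Ne.symm hy]
      · intro z hz
        simp [lookupA_eraseA, hne z hz]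

theorem RealP.beta [DecidableEq A] {c v w v' : Exp} {ρ ρv : PEnv A} {x : ℕ} {b : A}
    (h : RealP σ (Exp.lam x c) ρ w) (hσ : σ.ClosedClo) (hb : σ b = none) (hval : IsValue v)
    (hv : RealP σ v ρv v') (hc : Closed v') :
    ∃ c', w = Exp.lam x c' ∧
      RealP (σ.upd b (Storable.clo v ρv)) c (updA ρ x b) (subst v' x c') := by
  have hext := Store.ext_upd hb (Storable.clo v ρv)
  cases h with
  | lam _ _ _ c' h =>
    refine ⟨c', rfl, (h.mono hext).bind (hσ.upd_clo hb hval hv hc) (Store.upd_self _ _ _)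
      (hv.mono hext) ?_ ?_ ?_⟩
    · simp [lookupA_eraseA]
    · simp [lookupA_updA]
    · intro y hy
      simp [lookupA_eraseA, lookupA_updA, hy]

theorem RealP.exists_of_var {x : ℕ} {ρ : PEnv A} {e' : Exp} (h : RealP σ (Exp.var x) ρ e')
    (hc : Closed e') : ∃ l v ρ', lookupA ρ x = some l ∧
      σ l = some (Storable.clo v ρ') ∧ RealP σ v ρ' e' := by
  cases h with
  | varHit _ _ l v ρ' _ hl hs h => exact ⟨l, v, ρ', hl, hs, h⟩
  | varMiss => exact absurd hc (not_closed_var x)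

/-! ## Machine runs are simulated by standard reduction -/

/-- `KPlug σ a e r`: plugging `e` into the unfolding of the continuation at `a` yields `r`. -/
inductive KPlug (σ : Store A) : A → Exp → Exp → Prop where
  | mt {a : A} {e : Exp} : σ a = some (Storable.kont Kont.mt) → KPlug σ a e e
  | ar {a c : A} {e e₁ e₁' r : Exp} {ρ : PEnv A} :
      σ a = some (Storable.kont (Kont.ar e₁ ρ c)) → RealP σ e₁ ρ e₁' → Closed e₁' →
      KPlug σ c (Exp.app e e₁') r → KPlug σ a e r
  | fn {a c : A} {e v v' r : Exp} {ρ : PEnv A} :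
      σ a = some (Storable.kont (Kont.fn v ρ c)) → IsValue v → RealP σ v ρ v' → Closed v' →
      KPlug σ c (Exp.app v' e) r → KPlug σ a e r

theorem KPlug.mono {σ' : Store A} (hσ : σ.Ext σ') {a : A} {e r : Exp}
    (h : KPlug σ a e r) : KPlug σ' a e r := by
  induction h with
  | mt h => exact .mt (hσ _ _ h)
  | ar h hr hc _ ih => exact .ar (hσ _ _ h) (hr.mono hσ) hc ih
  | fn h hv hr hc _ ih => exact .fn (hσ _ _ h) hv (hr.mono hσ) hc ih

theorem KPlug.stdStep {a : A} {e e₂ r : Exp} (h : KPlug σ a e r) (hs : StdStep e e₂) :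
    ∃ r₂, KPlug σ a e₂ r₂ ∧ StdStep r r₂ := by
  induction h generalizing e₂ with
  | mt h => exact ⟨e₂, .mt h, hs⟩
  | ar h hr hc _ ih =>
    obtain ⟨r₂, hk, hs'⟩ := ih (hs.appL _)
    exact ⟨r₂, .ar h hr hc hk, hs'⟩
  | fn h hv hr hc _ ih =>
    obtain ⟨r₂, hk, hs'⟩ := ih (hs.appR (hr.isValue hv))
    exact ⟨r₂, .fn h hv hr hc hk, hs'⟩

/-- The state `ς` unfolds to the expression `r`. -/
def CeskState.Unfolds (ς : CeskState A) (r : Exp) : Prop :=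
  ς.sto.ClosedClo ∧ ∃ e', RealP ς.sto ς.exp ς.env e' ∧ Closed e' ∧ KPlug ς.sto ς.kptr e' r

theorem CeskStep.ext [DecidableEq A] {ς ς' : CeskState A} (h : CeskStep ς ς') :
    ς.sto.Ext ς'.sto := by
  cases h with
  | var => exact fun _ _ h => h
  | app _ _ _ _ _ _ _ _ hb => exact Store.ext_upd hb _
  | ar _ _ _ _ _ _ _ _ _ _ hb => exact Store.ext_upd hb _
  | fn _ _ _ _ _ _ _ _ _ _ _ hb => exact Store.ext_upd hb _

theorem CeskStep.unfolds [DecidableEq A] {ς ς' : CeskState A} {r : Exp} (h : CeskStep ς ς')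
    (hr : ς.Unfolds r) : ∃ r', ς'.Unfolds r' ∧ Relation.ReflTransGen StdStep r r' := by
  obtain ⟨hσ, e', hr, hc, hk⟩ := hr
  cases h with
  | var x ρ σ a κ l v ρ' hκ hl hs =>
    obtain ⟨l', w, ρ'', hl', hs', hw⟩ := hr.exists_of_var hc
    obtain rfl : l = l' := by simpa [hl] using hl'
    obtain ⟨rfl, rfl⟩ : v = w ∧ ρ' = ρ'' := by simpa [hs] using hs'
    exact ⟨r, ⟨hσ, e', hw, hc, hk⟩, .refl⟩
  | app e₀ e₁ ρ σ a κ b hκ hb =>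
    have hext := Store.ext_upd hb (Storable.kont (Kont.ar e₁ ρ a))
    cases hr with
    | app _ _ _ e₀' e₁' h₀ h₁ =>
      obtain ⟨hc₀, hc₁⟩ := closed_app.mp hc
      exact ⟨r, ⟨hσ.upd_kont hb _, e₀', h₀.mono hext, hc₀,
        .ar (Store.upd_self _ _ _) (h₁.mono hext) hc₁ (hk.mono hext)⟩, .refl⟩
  | ar v ρ σ a e ρ' c b hv hκ hb =>
    have hext := Store.ext_upd hb (Storable.kont (Kont.fn v ρ c))
    cases hk with
    | mt h => simp [hκ] at h
    | fn h => simp [hκ] at h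
    | @ar _ c' _ f f' _ ρf h hf hcf hk =>
      obtain ⟨rfl, rfl, rfl⟩ : e = f ∧ ρ' = ρf ∧ c = c' := by simpa [hκ] using h
      exact ⟨r, ⟨hσ.upd_kont hb _, f', hf.mono hext, hcf,
        .fn (Store.upd_self _ _ _) hv (hr.mono hext) hc (hk.mono hext)⟩, .refl⟩
  | fn v ρ σ a x e ρ' c b hv hκ hb =>
    have hext := Store.ext_upd hb (Storable.clo v ρ)
    cases hk with
    | mt h => simp [hκ] at h
    | ar h => simp [hκ] at h
    | @fn _ c' _ f f' _ ρf h hvf hf hcf hk =>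
      obtain ⟨rfl, rfl, rfl⟩ : Exp.lam x e = f ∧ ρ' = ρf ∧ c = c' := by simpa [hκ] using h
      obtain ⟨d, rfl, hd⟩ := hf.beta hσ hb hv hr hc
      obtain ⟨r', hk', hs⟩ :=
        hk.stdStep (StdStep.mk Ctx.hole x d e' ECtx.hole (hr.isValue hv))
      exact ⟨r', ⟨hσ.upd_clo hb hv hr hc, _, hd, closed_subst hcf hc, hk'.mono hext⟩,
        .single hs⟩

theorem unfolds_of_reflTransGen [DecidableEq A] {ς ς' : CeskState A} {r : Exp}
    (h : Relation.ReflTransGen CeskStep ς ς') (hr : ς.Unfolds r) :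
    ς.sto.Ext ς'.sto ∧ ∃ r', ς'.Unfolds r' ∧ Relation.ReflTransGen StdStep r r' := by
  induction h with
  | refl => exact ⟨fun _ _ h => h, r, hr, .refl⟩
  | tail _ h ih =>
    obtain ⟨hext, r', hr', hs⟩ := ih
    obtain ⟨r'', hr'', hs'⟩ := h.unfolds hr'
    exact ⟨hext.trans h.ext, r'', hr'', hs.trans hs'⟩

theorem closedClo_initStore [DecidableEq A] (a₀ : A) : (initStore a₀).ClosedClo := by
  intro l v ρ h
  by_cases hl : l = a₀ <;> simp [initStore, hl] at h

theorem initStore_self [DecidableEq A] (a₀ : A) :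
    initStore a₀ a₀ = some (Storable.kont Kont.mt) := by
  simp [initStore]

theorem unfolds_injCesk [DecidableEq A] (a₀ : A) {e : Exp} (he : Closed e) :
    (injCesk a₀ e).Unfolds e :=
  ⟨closedClo_initStore a₀, e, RealP.nil _ e, he, .mt (initStore_self a₀)⟩

end

/-! ## Big-step evaluation is simulated by machine runs -/

/-- Stores with finite domain, in which fresh addresses therefore exist. -/
def Store.FinDom {A : Type} (σ : Store A) : Prop := {a | σ a ≠ none}.Finite

theorem Store.FinDom.upd {A : Type} [DecidableEq A] {σ : Store A} (h : σ.FinDom) (b : A)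
    (s : Storable A) : (σ.upd b s).FinDom := by
  refine (h.insert b).subset fun a ha => ?_
  by_cases hab : a = b
  · exact Or.inl hab
  · exact Or.inr (by simpa [Store.upd, hab] using ha)

theorem Store.FinDom.exists_fresh {A : Type} [Infinite A] {σ : Store A} (h : σ.FinDom) :
    ∃ b, σ b = none := by
  obtain ⟨b, hb⟩ := h.exists_notMem
  exact ⟨b, by simpa using hb⟩

theorem finDom_initStore {A : Type} [DecidableEq A] (a₀ : A) : (initStore a₀).FinDom := by
  refine (Set.finite_singleton a₀).subset fun a ha => ?_
  by_contra h
  exact ha (by simp_all [initStore])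

/-- From `ς`, the machine returns a value unfolding to `v'` to the continuation `a`. -/
def Returns {A : Type} [DecidableEq A] (ς : CeskState A) (a : A) (v' : Exp) : Prop :=
  ∃ v ρ σ, IsValue v ∧ Relation.ReflTransGen CeskStep ς ⟨v, ρ, σ, a⟩ ∧
    RealP σ v ρ v' ∧ Closed v' ∧ ς.sto.Ext σ ∧ σ.ClosedClo ∧ σ.FinDom

theorem BigStep.returns {A : Type} [DecidableEq A] [Infinite A] {e' v' : Exp}
    (h : BigStep e' v') {e : Exp} {ρ : PEnv A} {σ : Store A} {a : A} {κ : Kont A}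
    (hr : RealP σ e ρ e') (hc : Closed e') (hσ : σ.ClosedClo) (hfin : σ.FinDom)
    (hκ : σ a = some (Storable.kont κ)) : Returns ⟨e, ρ, σ, a⟩ a v' := by
  induction h generalizing e ρ σ a κ with
  | lam x b' =>
    cases hr with
    | lam _ b _ _ h =>
      exact ⟨Exp.lam x b, ρ, σ, ⟨x, b, rfl⟩, .refl, .lam _ _ _ _ h, hc,
        fun _ _ h => h, hσ, hfin⟩
    | varHit y _ l v ρ' _ hl hs h =>
      exact ⟨v, ρ', σ, (hσ l v ρ' hs).1, .single (.var y ρ σ a κ l v ρ' hκ hl hs), h, hc,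
        fun _ _ h => h, hσ, hfin⟩
  | @app e₀' e₁' x d' u' w' _ _ _ ih₀ ih₁ ih₂ =>
    cases hr with
    | varHit y _ l v ρ' _ hl hs h =>
      obtain ⟨_, _, h⟩ := h.isValue (hσ l v ρ' hs).1
      cases h
    | app e₀ e₁ _ _ _ h₀ h₁ =>
      obtain ⟨hc₀, hc₁⟩ := closed_app.mp hc
      obtain ⟨b, hb⟩ := hfin.exists_fresh
      have hext := Store.ext_upd hb (Storable.kont (Kont.ar e₁ ρ a))
      have hself := Store.upd_self σ b (Storable.kont (Kont.ar e₁ ρ a))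
      obtain ⟨f, ρf, σ₁, hf, run₁, hrf, hcf, hext₁, hσ₁, hfin₁⟩ :=
        ih₀ (h₀.mono hext) hc₀ (hσ.upd_kont hb _) (hfin.upd _ _) hself
      obtain ⟨b₁, hb₁⟩ := hfin₁.exists_fresh
      have hext₁' := Store.ext_upd hb₁ (Storable.kont (Kont.fn f ρf a))
      have hself₁ := Store.upd_self σ₁ b₁ (Storable.kont (Kont.fn f ρf a))
      have hext₀₁ := (hext.trans hext₁).trans hext₁'
      obtain ⟨u, ρu, σ₂, hu, run₂, hru, hcu, hext₂, hσ₂, hfin₂⟩ :=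
        ih₁ (h₁.mono hext₀₁) hc₁ (hσ₁.upd_kont hb₁ _) (hfin₁.upd _ _) hself₁
      obtain ⟨b₂, hb₂⟩ := hfin₂.exists_fresh
      have hext₂' := Store.ext_upd hb₂ (Storable.clo u ρu)
      have hext₀₂ := (hext₀₁.trans hext₂).trans hext₂'
      obtain ⟨y, d, rfl⟩ := hf
      obtain ⟨d'', hd, hrd⟩ := ((hrf.mono hext₁').mono hext₂).beta hσ₂ hb₂ hu hru hcu
      cases hrf with
      | lam _ _ _ _ _ =>
      cases hd
      obtain ⟨w, ρw, σ₃, hw, run₃, hrw, hcw, hext₃, hσ₃, hfin₃⟩ :=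
        ih₂ hrd (closed_subst hcf hcu) (hσ₂.upd_clo hb₂ hu hru hcu) (hfin₂.upd _ _)
          (hext₀₂ _ _ hκ)
      have step₀ := CeskStep.app e₀ e₁ ρ σ a κ b hκ hb
      have step₁ := CeskStep.ar _ ρf σ₁ b e₁ ρ a b₁ ⟨x, d, rfl⟩ (hext₁ _ _ hself) hb₁
      have step₂ := CeskStep.fn u ρu σ₂ b₁ x d ρf a b₂ hu (hext₂ _ _ hself₁) hb₂
      exact ⟨w, ρw, σ₃, hw,
        ((run₁.head step₀).trans (run₂.head step₁)).trans (run₃.head step₂),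
        hrw, hcw, hext₀₂.trans hext₃, hσ₃, hfin₃⟩

/-- CESK* correctness: `eval_CESK* = eval`, where
`eval_CESK*(e) = real(v,ρ,σ)` whenever the machine started at
`⟨e,∅,[a₀↦mt],a₀⟩` reaches `⟨v,ρ,σ,a₀⟩`. -/
theorem cesk_correct (e : Exp) (he : Closed e) (v' : Exp) :
    (∃ (v : Exp) (ρ : PEnv ℕ) (σ : Store ℕ), IsValue v ∧
        Relation.ReflTransGen CeskStep (injCesk 0 e) ⟨v, ρ, σ, 0⟩ ∧
        RealP σ v ρ v') ↔
      (IsValue v' ∧ Relation.ReflTransGen StdStep e v') := by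
  constructor
  · rintro ⟨v, ρ, σ, hv, run, hr⟩
    obtain ⟨hext, r, ⟨_, w, hw, _, hk⟩, hs⟩ :=
      unfolds_of_reflTransGen run (unfolds_injCesk 0 he)
    have hmt : σ 0 = some (Storable.kont Kont.mt) := hext _ _ (initStore_self (0 : ℕ))
    obtain rfl : w = v' := hw.deterministic hr
    refine ⟨hr.isValue hv, ?_⟩
    cases hk with
    | mt => exact hs
    | ar h => simp [hmt] at h
    | fn h => simp [hmt] at h
  · rintro ⟨hv, hs⟩
    obtain ⟨v, ρ, σ, hval, run, hr, _⟩ :=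
      (bigStep_of_reflTransGen hs hv).returns (RealP.nil _ e) he (closedClo_initStore 0)
        (finDom_initStore 0) (initStore_self (0 : ℕ))
    exact ⟨v, ρ, σ, hval, run, hr⟩
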